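/- Let P_1, P_2, N_1, N_3 > 0 with N_1 <= N_3. Then the supremum of R2 over all rate pairs (R1,R2) in the achievable region of Proposition 3 (i.e., the supremum over rho_1, rho_2 in [0,1], alpha_{13} > 0 and P'_2 + P''_2 <= P_2 of the minimum of the R2-bound C(rhobar_2 P'_2/(rhobar_2 P''_2 + N_1)) + C(rhobar_2 P''_2/(((1-alpha_{13})/alpha_{13})^2 rhobar_1 P_1 + N_3)) and the sum-rate bound C(-1 + rhobar_1 P_1/((1-alpha_{13})^2 rhobar_1 P_1 + alpha_{13}^2 N_3))) equals min{ C(P_2/N_1), C(P_1/N_3) }. -/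

import Mathlib

noncomputable section

namespace Stmt5

/-- `C(x) = (1/2) log₂ (1+x)`. -/
def Cfun (x : ℝ) : ℝ := (1 / 2) * Real.logb 2 (1 + x)

/-- The achievable rate region of Proposition 3 for the dirty Gaussian GMAC with the
interference known noncausally only at encoder 1: the union over `ρ₁, ρ₂ ∈ [0,1]`,
`α₁₃ > 0`, and `P₂', P₂'' ≥ 0` with `P₂' + P₂'' ≤ P₂`, of the rate pairs
`(R₁, R₂)` with `R₁, R₂ ≥ 0` satisfying the `R₂`-bound and the sum-rate bound. -/
def region3 (P1 P2 N1 N3 : ℝ) : Set (ℝ × ℝ) :=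
  {R : ℝ × ℝ | 0 ≤ R.1 ∧ 0 ≤ R.2 ∧
    ∃ ρ1 ρ2 α13 P2' P2'' : ℝ,
      ρ1 ∈ Set.Icc (0 : ℝ) 1 ∧ ρ2 ∈ Set.Icc (0 : ℝ) 1 ∧ 0 < α13 ∧
      0 ≤ P2' ∧ 0 ≤ P2'' ∧ P2' + P2'' ≤ P2 ∧
      R.2 ≤ Cfun ((1 - ρ2) * P2' / ((1 - ρ2) * P2'' + N1)) +
            Cfun ((1 - ρ2) * P2'' / (((1 - α13) / α13) ^ 2 * (1 - ρ1) * P1 + N3)) ∧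
      R.1 + R.2 ≤ Cfun (-1 + (1 - ρ1) * P1 /
            ((1 - α13) ^ 2 * (1 - ρ1) * P1 + α13 ^ 2 * N3))}

lemma Cfun_nonneg {x : ℝ} (hx : 0 ≤ x) : 0 ≤ Cfun x :=
  mul_nonneg (by norm_num) (Real.logb_nonneg (by norm_num) (by linarith))

lemma Cfun_mono {x y : ℝ} (hx : -1 < x) (hxy : x ≤ y) : Cfun x ≤ Cfun y :=
  mul_le_mul_of_nonneg_left
    (Real.logb_le_logb_of_le (by norm_num) (by linarith) (by linarith)) (by norm_num)

/-- Superposition of two layers `a`, `b` is no better than a single layer at the smaller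
noise level. -/
lemma Cfun_add_Cfun_le {a b p M N : ℝ} (ha : 0 ≤ a) (hb : 0 ≤ b) (hp : a + b ≤ p)
    (hN : 0 < N) (hNM : N ≤ M) :
    Cfun (a / (b + N)) + Cfun (b / M) ≤ Cfun (p / N) := by
  have hbN : 0 < b + N := by linarith
  calc Cfun (a / (b + N)) + Cfun (b / M) ≤ Cfun (a / (b + N)) + Cfun (b / N) := by
        have hM : 0 ≤ b / M := div_nonneg hb (hN.le.trans hNM)
        gcongr
        exact Cfun_mono (by linarith) (div_le_div_of_nonneg_left hb hN hNM)
    _ = Cfun ((a + b) / N) := by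
        have h₁ : 0 < 1 + a / (b + N) := by positivity
        have h₂ : 0 < 1 + b / N := by positivity
        have h : 1 + (a + b) / N = (1 + a / (b + N)) * (1 + b / N) := by
          field_simp
          ring
        simp only [Cfun]
        rw [h, Real.logb_mul h₁.ne' h₂.ne']
        ring
    _ ≤ Cfun (p / N) := by
        have h : 0 ≤ (a + b) / N := by positivity
        exact Cfun_mono (by linarith) (by gcongr)

/-- The sum-rate bound is maximized by the inflation factor `q / (q + N)`. -/
lemma Cfun_sumRate_le {q P N α : ℝ} (hq : 0 ≤ q) (hqP : q ≤ P) (hN : 0 < N) (hα : 0 < α) :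
    Cfun (-1 + q / ((1 - α) ^ 2 * q + α ^ 2 * N)) ≤ Cfun (P / N) := by
  rcases hq.eq_or_lt with rfl | hq
  · simpa [Cfun] using Cfun_nonneg (div_nonneg hqP hN.le)
  have hD : 0 < (1 - α) ^ 2 * q + α ^ 2 * N := by positivity
  have hpos : 0 < q / ((1 - α) ^ 2 * q + α ^ 2 * N) := by positivity
  have hle : q / ((1 - α) ^ 2 * q + α ^ 2 * N) ≤ (q + N) / N := by
    rw [div_le_div_iff₀ hD hN]
    nlinarith [sq_nonneg ((1 - α) * q - α * N)]
  have hqN : (q + N) / N = q / N + 1 := by field_simp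
  have hqPN : q / N ≤ P / N := by gcongr
  exact Cfun_mono (by linarith) (by linarith)

/-- **Maximum of `R₂` in Proposition 3 when `N₁ ≤ N₃`.** The supremum of `R₂` over the
achievable region equals `min { C(P₂/N₁), C(P₁/N₃) }`. -/
theorem maxR2_of_N1_le_N3 (P1 P2 N1 N3 : ℝ)
    (hP1 : 0 < P1) (hP2 : 0 < P2) (hN1 : 0 < N1) (hN3 : 0 < N3) (hN : N1 ≤ N3) :
    sSup {r2 : ℝ | ∃ r1 : ℝ, (r1, r2) ∈ region3 P1 P2 N1 N3} =
      min (Cfun (P2 / N1)) (Cfun (P1 / N3)) := by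
  refine IsGreatest.csSup_eq ⟨⟨0, le_rfl, ?_, 0, 0, P1 / (P1 + N3), P2, 0, by simp, by simp,
    by positivity, hP2.le, le_rfl, by simp, ?_, ?_⟩, ?_⟩
  · exact le_min (Cfun_nonneg (by positivity)) (Cfun_nonneg (by positivity))
  · exact (min_le_left _ _).trans (by simp [Cfun])
  · have h : -1 + (1 - 0) * P1 / ((1 - P1 / (P1 + N3)) ^ 2 * (1 - 0) * P1 +
        (P1 / (P1 + N3)) ^ 2 * N3) = P1 / N3 := by
      have h₁ : 1 - P1 / (P1 + N3) = N3 / (P1 + N3) := by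
        field_simp
        ring
      have h₂ : (N3 / (P1 + N3)) ^ 2 * (1 - 0) * P1 + (P1 / (P1 + N3)) ^ 2 * N3 =
          P1 * N3 / (P1 + N3) := by
        field_simp
        ring
      rw [h₁, h₂]
      field_simp
      ring
    rw [h, zero_add]
    exact min_le_right _ _
  · rintro r2 ⟨r1, hr1, -, ρ1, ρ2, α, p, p', ⟨hρ1, hρ1'⟩, ⟨hρ2, hρ2'⟩, hα, hp, hp', hpp,
      hR2, hsum⟩
    have hσ1 : 0 ≤ 1 - ρ1 := by linarith
    have hσ2 : 0 ≤ 1 - ρ2 := by linarith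
    refine le_min (hR2.trans (Cfun_add_Cfun_le (by positivity) (by positivity) ?_ hN1 ?_)) ?_
    · nlinarith [mul_nonneg hρ2 (add_nonneg hp hp')]
    · have : 0 ≤ ((1 - α) / α) ^ 2 * (1 - ρ1) * P1 := by positivity
      linarith
    · rw [mul_assoc ((1 - α) ^ 2)] at hsum
      have hr1 : 0 ≤ r1 := hr1
      have := Cfun_sumRate_le (q := (1 - ρ1) * P1) (by positivity)
        (mul_le_of_le_one_left hP1.le (by linarith)) hN3 hα
      dsimp only at hsum
      linarith

end Stmt5
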